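/- arXiv:1910.04228 — 4 statements merged into one kernel-verified Lean document; each statement's English description precedes it below -/
import Mathlib

section
/- For every path π = v_0,…,v_n in G, the greedy power assignment p*_π has minimum cost among all power assignments that activate every edge of π; that is, cost(p*_π) = opt(π). -/
/-- The greedy power values along a path `v 0, v 1, …`: power `0` at the first
vertex, and at each subsequent vertex exactly the power needed to activate the
incoming edge, given the power already present at the previous vertex. -/
def greedyVal {V : Type*} (w : V → V → ℝ) (v : ℕ → V) : ℕ → ℝ
  | 0 => 0
  | i + 1 => max 0 (w (v i) (v (i + 1)) - greedyVal w v i)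

/-- The greedy power assignment `p*_π` along the path `v 0, …, v m`:
vertices on the path get their greedy value, vertices off the path get `0`. -/
noncomputable def greedyAssign {V : Type*} [DecidableEq V] (w : V → V → ℝ) (v : ℕ → V)
    (m : ℕ) : V → ℝ :=
  fun x => ∑ i ∈ Finset.range (m + 1), if v i = x then greedyVal w v i else 0

theorem greedyVal_nonneg {V : Type*} (w : V → V → ℝ) (v : ℕ → V) (i : ℕ) :
    0 ≤ greedyVal w v i := by
  cases i with
  | zero => exact le_rfl
  | succ i => exact le_max_left _ _

theorem greedyAssign_nonneg {V : Type*} [DecidableEq V] (w : V → V → ℝ) (v : ℕ → V)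
    (m : ℕ) (x : V) : 0 ≤ greedyAssign w v m x :=
  Finset.sum_nonneg fun i _ => by
    split_ifs
    exacts [greedyVal_nonneg w v i, le_rfl]

theorem greedyAssign_apply {V : Type*} [DecidableEq V] (w : V → V → ℝ) {v : ℕ → V}
    {m : ℕ} (hinj : Set.InjOn v (Set.Iic m)) {i : ℕ} (hi : i ≤ m) :
    greedyAssign w v m (v i) = greedyVal w v i := by
  unfold greedyAssign
  rw [Finset.sum_eq_single_of_mem i (Finset.mem_range.2 (Nat.lt_succ_of_le hi)), if_pos rfl]
  intro j hj hji
  exact if_neg fun h => hji (hinj (Finset.mem_range_succ_iff.1 hj) hi h)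

theorem sum_greedyAssign {V : Type*} [Fintype V] [DecidableEq V] (w : V → V → ℝ)
    (v : ℕ → V) (m : ℕ) :
    ∑ x, greedyAssign w v m x = ∑ i ∈ Finset.range (m + 1), greedyVal w v i := by
  unfold greedyAssign
  rw [Finset.sum_comm]
  simp

/-- Any nonnegative sequence activating the edges of the path costs at least as much as the
greedy one, and the surplus is at least the surplus at the last vertex. -/
theorem sum_greedyVal_le {V : Type*} (w : V → V → ℝ) (v : ℕ → V) (q : ℕ → ℝ)
    (hq : ∀ i, 0 ≤ q i) (n : ℕ) (hact : ∀ i < n, w (v i) (v (i + 1)) ≤ q i + q (i + 1)) :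
    ∑ i ∈ Finset.range (n + 1), greedyVal w v i ≤ ∑ i ∈ Finset.range (n + 1), q i ∧
      q n - greedyVal w v n ≤
        ∑ i ∈ Finset.range (n + 1), q i - ∑ i ∈ Finset.range (n + 1), greedyVal w v i := by
  induction n with
  | zero => simpa [greedyVal] using hq 0
  | succ n ih =>
    obtain ⟨h₁, h₂⟩ := ih fun i hi => hact i (hi.trans n.lt_succ_self)
    have hn := hact n n.lt_succ_self
    have hq' := hq (n + 1)
    rw [Finset.sum_range_succ _ (n + 1), Finset.sum_range_succ q (n + 1)]
    refine ⟨?_, by linarith⟩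
    rcases max_choice 0 (w (v n) (v (n + 1)) - greedyVal w v n) with h | h <;>
      rw [greedyVal.eq_2, h] <;> linarith

/-- For every path `π = v 0, …, v m` in `G`, the greedy power assignment `p*_π`
has minimum cost among all nonnegative power assignments activating every edge
of `π`; i.e. `cost (p*_π) = opt π`. -/
theorem greedy_cost_eq_opt {V : Type*} [Fintype V] [DecidableEq V]
    (G : SimpleGraph V) (w : V → V → ℝ)
    (hsymm : ∀ u x, w u x = w x u)
    (hpos : ∀ u x, G.Adj u x → 0 < w u x)
    (v : ℕ → V) (m : ℕ)
    (hadj : ∀ i < m, G.Adj (v i) (v (i + 1)))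
    (hinj : Set.InjOn v (Set.Iic m)) :
    IsLeast
      {c : ℝ | ∃ p : V → ℝ, (∀ x, 0 ≤ p x) ∧
        (∀ i < m, w (v i) (v (i + 1)) ≤ p (v i) + p (v (i + 1))) ∧
        c = ∑ x, p x}
      (∑ x, greedyAssign w v m x) := by
  refine ⟨⟨greedyAssign w v m, greedyAssign_nonneg w v m, fun i hi => ?_, rfl⟩, ?_⟩
  · rw [greedyAssign_apply w hinj hi.le, greedyAssign_apply w hinj (Nat.succ_le_of_lt hi),
      greedyVal.eq_2]
    linarith [le_max_right 0 (w (v i) (v (i + 1)) - greedyVal w v i)]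
  · rintro c ⟨p, hp, hact, rfl⟩
    rw [sum_greedyAssign]
    refine (sum_greedyVal_le w v (fun i => p (v i)) (fun i => hp _) m hact).1.trans ?_
    have hinj' : Set.InjOn v (Finset.range (m + 1)) := fun i hi j hj h =>
      hinj (Finset.mem_range_succ_iff.1 hi) (Finset.mem_range_succ_iff.1 hj) h
    rw [← Finset.sum_image hinj']
    exact Finset.sum_le_sum_of_subset_of_nonneg (Finset.subset_univ _) fun x _ _ => hp x
end

section
/- Let π be the path v_0,…,v_n in G and let π' be the path v_0,…,v_n,u obtained by extending π by one additional edge v_n u. Then φ(π') = max{0, w(v_n u) − φ(π)} and opt(π') = opt(π) + φ(π'). -/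
/-- The set of costs of nonnegative power assignments activating every edge of
the path `v 0, …, v m`;  `opt π` is the least element of this set. -/
def feasCosts {V : Type*} [Fintype V] (w : V → V → ℝ) (v : ℕ → V) (m : ℕ) : Set ℝ :=
  {c : ℝ | ∃ p : V → ℝ, (∀ x, 0 ≤ p x) ∧
    (∀ i < m, w (v i) (v (i + 1)) ≤ p (v i) + p (v (i + 1))) ∧
    c = ∑ x, p x}

theorem le_greedyVal_add_succ {V : Type*} (w : V → V → ℝ) (v : ℕ → V) (i : ℕ) :
    w (v i) (v (i + 1)) ≤ greedyVal w v i + greedyVal w v (i + 1) := by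
  have h : w (v i) (v (i + 1)) - greedyVal w v i ≤ greedyVal w v (i + 1) := le_max_right _ _
  linarith

/-- Any nonnegative activating sequence costs at least as much as the greedy one, with a surplus
of at least the excess of its final value over the greedy final value. -/
theorem sum_greedyVal_add_excess_le {V : Type*} (w : V → V → ℝ) (v : ℕ → V) (a : ℕ → ℝ)
    (ha : ∀ i, 0 ≤ a i) (m : ℕ) (hact : ∀ i < m, w (v i) (v (i + 1)) ≤ a i + a (i + 1)) :
    (∑ i ∈ Finset.range (m + 1), greedyVal w v i) + max 0 (a m - greedyVal w v m) ≤
      ∑ i ∈ Finset.range (m + 1), a i := by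
  induction m with
  | zero => simp [greedyVal, ha 0]
  | succ m ih =>
    have hm := ih fun i hi => hact i (by omega)
    have hlast := hact m (by omega)
    have hnonneg := ha (m + 1)
    have hstep : greedyVal w v (m + 1) = max 0 (w (v m) (v (m + 1)) - greedyVal w v m) := rfl
    rw [Finset.sum_range_succ _ (m + 1), Finset.sum_range_succ _ (m + 1)]
    grind

/-- The greedy power assignment along an injective path is optimal. -/
theorem isLeast_feasCosts_sum_greedyVal {V : Type*} [Fintype V] (w : V → V → ℝ) (v : ℕ → V)
    (m : ℕ) (hinj : Set.InjOn v (Set.Iic m)) :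
    IsLeast (feasCosts w v m) (∑ i ∈ Finset.range (m + 1), greedyVal w v i) := by
  classical
  constructor
  · let p : V → ℝ := fun x => ∑ i ∈ Finset.range (m + 1), if v i = x then greedyVal w v i else 0
    have hp : ∀ i ≤ m, p (v i) = greedyVal w v i := by
      intro i hi
      have hsingle := Finset.sum_eq_single_of_mem
        (f := fun j => if v j = v i then greedyVal w v j else 0) i
        (Finset.mem_range.mpr (Nat.lt_succ_of_le hi)) fun j hj hji =>
          if_neg fun h => hji (hinj (Nat.le_of_lt_succ (Finset.mem_range.mp hj)) hi h)
      simpa [p] using hsingle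
    refine ⟨p, fun x => Finset.sum_nonneg fun i _ => ?_, fun i hi => ?_, ?_⟩
    · split_ifs
      exacts [greedyVal_nonneg w v i, le_rfl]
    · rw [hp i hi.le, hp (i + 1) hi]
      exact le_greedyVal_add_succ w v i
    · simp only [p]
      rw [Finset.sum_comm]
      simp
  · rintro _ ⟨p, hp, hact, rfl⟩
    have hlower := sum_greedyVal_add_excess_le w v (fun i => p (v i)) (fun i => hp _) m hact
    have hpath : ∑ i ∈ Finset.range (m + 1), p (v i) ≤ ∑ x, p x := by
      rw [← Finset.sum_image (s := Finset.range (m + 1)) (g := v) fun i hi j hj h =>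
        hinj (Nat.le_of_lt_succ (Finset.mem_range.mp hi))
          (Nat.le_of_lt_succ (Finset.mem_range.mp hj)) h]
      exact Finset.sum_le_univ_sum_of_nonneg hp
    linarith [le_max_left 0 (p (v m) - greedyVal w v m)]

/-- Let `π` be the path `v 0, …, v m` and `π'` the path `v 0, …, v m, v (m+1)`
obtained by extending `π` by one edge.  Then `φ(π') = max {0, w(v m, v (m+1)) − φ(π)}`
and `opt(π') = opt(π) + φ(π')`, where `φ` denotes the greedy power at the final
vertex of a path. -/
theorem greedy_extend {V : Type*} [Fintype V] [DecidableEq V]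
    (G : SimpleGraph V) (w : V → V → ℝ)
    (hsymm : ∀ u x, w u x = w x u)
    (hpos : ∀ u x, G.Adj u x → 0 < w u x)
    (v : ℕ → V) (m : ℕ)
    (hadj : ∀ i < m + 1, G.Adj (v i) (v (i + 1)))
    (hinj : Set.InjOn v (Set.Iic (m + 1)))
    (c : ℝ) (hopt : IsLeast (feasCosts w v m) c) :
    greedyVal w v (m + 1) = max 0 (w (v m) (v (m + 1)) - greedyVal w v m) ∧
    IsLeast (feasCosts w v (m + 1)) (c + greedyVal w v (m + 1)) := by
  refine ⟨rfl, ?_⟩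
  have hm := isLeast_feasCosts_sum_greedyVal w v m
    (hinj.mono (Set.Iic_subset_Iic.mpr (Nat.le_succ m)))
  rw [hopt.unique hm, ← Finset.sum_range_succ]
  exact isLeast_feasCosts_sum_greedyVal w v (m + 1) hinj
end

section
/- Assume the weight function w : E → ℝ_{>0} takes only integer values, C is an integer, and α ∈ [0,1). Then there exists a power assignment p of cost at most C whose activated edges contain an s-t path if and only if there exists a power assignment p of cost at most C + α whose activated edges contain an s-t path. -/
/-- The edges of a path can be made bichromatic by a two-coloring of the vertices. -/
theorem SimpleGraph.Walk.IsPath.exists_bool_coloring {V : Type*} [DecidableEq V]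
    {G : SimpleGraph V} {s t : V} {q : G.Walk s t} (hq : q.IsPath) :
    ∃ c : V → Bool, ∀ d ∈ q.darts, c d.toProd.1 = !c d.toProd.2 := by
  induction q with
  | nil => exact ⟨fun _ => true, by simp⟩
  | @cons u v w h q ih =>
    rw [SimpleGraph.Walk.cons_isPath_iff] at hq
    obtain ⟨c, hc⟩ := ih hq.1
    refine ⟨Function.update c u (!c v), fun d hd => ?_⟩
    rw [SimpleGraph.Walk.darts_cons, List.mem_cons] at hd
    rcases hd with rfl | hd
    · simp [Function.update_of_ne h.ne']
    · have h1 : d.toProd.1 ≠ u := fun e => hq.2 (e ▸ q.dart_fst_mem_support_of_mem_darts hd)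
      have h2 : d.toProd.2 ≠ u := fun e => hq.2 (e ▸ q.dart_snd_mem_support_of_mem_darts hd)
      rw [Function.update_of_ne h1, Function.update_of_ne h2]
      exact hc d hd

theorem intervalIntegrable_floor_add (x a b : ℝ) :
    IntervalIntegrable (fun θ : ℝ => (⌊x + θ⌋ : ℝ)) MeasureTheory.volume a b := by
  refine Monotone.intervalIntegrable fun θ₁ θ₂ h => ?_
  exact_mod_cast Int.floor_mono (by linarith)

theorem integral_floor_add (x : ℝ) : ∫ θ in (0 : ℝ)..1, (⌊x + θ⌋ : ℝ) = x := by
  have hper : ∫ θ in x..x + 1, Int.fract θ = ∫ θ in (0 : ℝ)..0 + 1, Int.fract θ :=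
    Function.Periodic.intervalIntegral_add_eq (fun θ => by simp) x 0
  have hfract : ∫ θ in (0 : ℝ)..0 + 1, Int.fract θ = 1 / 2 := by
    rw [zero_add, intervalIntegral.integral_congr_Ioo_of_le (g := fun θ => θ) zero_le_one]
    · simp
    · exact fun θ hθ => Int.fract_eq_self.2 ⟨hθ.1.le, hθ.2⟩
  have hshift : ∫ θ in (0 : ℝ)..1, Int.fract (x + θ) = 1 / 2 := by
    rw [intervalIntegral.integral_comp_add_left (fun θ => Int.fract θ), add_zero, hper, hfract]
  have hlin : ∫ θ in (0 : ℝ)..1, (x + θ) = x + 1 / 2 := by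
    rw [intervalIntegral.integral_add (by simp) (by simp)]
    simp
  have hsub : ∫ θ in (0 : ℝ)..1, Int.fract (x + θ) =
      (∫ θ in (0 : ℝ)..1, (x + θ)) - ∫ θ in (0 : ℝ)..1, (⌊x + θ⌋ : ℝ) :=
    intervalIntegral.integral_sub ((by fun_prop : Continuous fun θ : ℝ => x + θ).intervalIntegrable
      _ _) (intervalIntegrable_floor_add x 0 1)
  linarith

/-- Rounding of `x` at threshold `θ`: to `⌊x + θ⌋` or to `⌈x - θ⌉`, depending on the color. -/
noncomputable def thresholdRound (θ : ℝ) (c : Bool) (x : ℝ) : ℤ :=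
  if c then ⌊x + θ⌋ else -⌊-x + θ⌋

theorem thresholdRound_nonneg {θ x : ℝ} (hθ : θ ∈ Set.Ioo (0 : ℝ) 1) (hx : 0 ≤ x) (c : Bool) :
    0 ≤ thresholdRound θ c x := by
  cases c
  · have : ⌊-x + θ⌋ < 1 := Int.floor_lt.2 (by push_cast; linarith [hθ.2])
    simp only [thresholdRound, Bool.false_eq_true, if_false]
    omega
  · exact Int.floor_nonneg.2 (by linarith [hθ.1])

theorem le_thresholdRound_add {x y : ℝ} {k : ℤ} (h : (k : ℝ) ≤ x + y) (θ : ℝ) (c : Bool) :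
    k ≤ thresholdRound θ (!c) x + thresholdRound θ c y := by
  have key : ∀ a b : ℝ, (k : ℝ) ≤ a + b → k + ⌊-b + θ⌋ ≤ ⌊a + θ⌋ := fun a b hab =>
    Int.le_floor.2 (by push_cast; linarith [Int.floor_le (-b + θ)])
  cases c
  · have := key x y h
    simp only [thresholdRound, Bool.not_false, Bool.false_eq_true, if_false, if_true]
    omega
  · have := key y x (by linarith)
    simp only [thresholdRound, Bool.not_true, Bool.false_eq_true, if_false, if_true]
    omega

theorem intervalIntegrable_thresholdRound (c : Bool) (x a b : ℝ) :
    IntervalIntegrable (fun θ => (thresholdRound θ c x : ℝ)) MeasureTheory.volume a b := by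
  cases c
  · simpa [thresholdRound, Pi.neg_def] using (intervalIntegrable_floor_add (-x) a b).neg
  · simpa [thresholdRound] using intervalIntegrable_floor_add x a b

theorem integral_thresholdRound (c : Bool) (x : ℝ) :
    ∫ θ in (0 : ℝ)..1, (thresholdRound θ c x : ℝ) = x := by
  cases c
  · simp [thresholdRound, integral_floor_add]
  · simp [thresholdRound, integral_floor_add]

/-- Some threshold rounds a vector without raising the sum of its entries to the next integer. -/
theorem exists_sum_thresholdRound_le {V : Type*} [Fintype V] (c : V → Bool) (p : V → ℝ) {C : ℤ}
    (hC : ∑ x, p x < C + 1) :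
    ∃ θ ∈ Set.Ioo (0 : ℝ) 1, ∑ x, thresholdRound θ (c x) (p x) ≤ C := by
  by_contra! hlt
  have hint : ∀ x ∈ Finset.univ, IntervalIntegrable
      (fun θ => (thresholdRound θ (c x) (p x) : ℝ)) MeasureTheory.volume 0 1 :=
    fun x _ => intervalIntegrable_thresholdRound _ _ _ _
  have hmono : ∫ _ in (0 : ℝ)..1, (C + 1 : ℝ) ≤
      ∫ θ in (0 : ℝ)..1, ∑ x, (thresholdRound θ (c x) (p x) : ℝ) := by
    refine intervalIntegral.integral_mono_on_of_le_Ioo zero_le_one (by simp)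
      (by simpa [Finset.sum_fn] using IntervalIntegrable.sum _ hint) fun θ hθ => ?_
    exact_mod_cast hlt θ hθ
  rw [intervalIntegral.integral_finsetSum hint] at hmono
  simp only [integral_thresholdRound, intervalIntegral.integral_const, sub_zero, one_smul] at hmono
  linarith


/-- The activated edges of the power assignment `p` contain a path from `s` to `t`:
there is a walk from `s` to `t` all of whose edges `uv` satisfy `p u + p v ≥ w u v`. -/
def ActivatedPath {V : Type*} (G : SimpleGraph V) (w : V → V → ℝ) (p : V → ℝ)
    (s t : V) : Prop :=
  ∃ q : G.Walk s t, ∀ d ∈ q.darts, w d.toProd.1 d.toProd.2 ≤ p d.toProd.1 + p d.toProd.2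

/-- If the weight function takes only integer values, `C` is an integer, and
`α ∈ [0,1)`, then there is a nonnegative power assignment of cost at most `C`
whose activated edges contain an `s`-`t` path iff there is one of cost at most
`C + α` whose activated edges contain an `s`-`t` path. -/
theorem installation_integral_threshold {V : Type*} [Fintype V] [DecidableEq V]
    (G : SimpleGraph V) (w : V → V → ℝ)
    (hsymm : ∀ u x, w u x = w x u)
    (hpos : ∀ u x, G.Adj u x → 0 < w u x)
    (hint : ∀ u x, G.Adj u x → ∃ k : ℤ, w u x = k)
    (s t : V) (C : ℤ) (α : ℝ) (hα0 : 0 ≤ α) (hα1 : α < 1) :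
    (∃ p : V → ℝ, (∀ x, 0 ≤ p x) ∧ (∑ x, p x) ≤ (C : ℝ) ∧ ActivatedPath G w p s t) ↔
    (∃ p : V → ℝ, (∀ x, 0 ≤ p x) ∧ (∑ x, p x) ≤ (C : ℝ) + α ∧ ActivatedPath G w p s t) := by
  constructor
  · rintro ⟨p, hp, hcost, hpath⟩
    exact ⟨p, hp, by linarith, hpath⟩
  · rintro ⟨p, hp, hcost, q, hq⟩
    obtain ⟨c, hc⟩ := q.bypass_isPath.exists_bool_coloring
    obtain ⟨θ, hθ, hsum⟩ := exists_sum_thresholdRound_le c p (C := C) (by linarith)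
    refine ⟨fun x => thresholdRound θ (c x) (p x),
      fun x => Int.cast_nonneg (thresholdRound_nonneg hθ (hp x) (c x)),
      by beta_reduce; exact_mod_cast hsum, q.bypass, fun d hd => ?_⟩
    obtain ⟨k, hk⟩ := hint _ _ d.adj
    have hle := hq d (q.darts_bypass_subset_darts hd)
    rw [hk] at hle ⊢
    have := le_thresholdRound_add hle θ (c d.toProd.2)
    rw [← hc d hd] at this
    beta_reduce
    exact_mod_cast this
end

section
/- Let λ be the smallest value such that the constant power assignment p(v) = λ (for every vertex v) activates at least one s-t path, and let OPT be the minimum cost of a power assignment whose activated edges contain an s-t path. Then λ ≤ OPT. -/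
/-- If `lam` is the smallest value such that the constant power assignment
`p v = lam` activates at least one `s`-`t` path, and `OPT` is the minimum cost of
a nonnegative power assignment whose activated edges contain an `s`-`t` path,
then `lam ≤ OPT`. -/
theorem lambda_le_opt {V : Type*} [Fintype V] [DecidableEq V]
    (G : SimpleGraph V) (w : V → V → ℝ)
    (hsymm : ∀ u x, w u x = w x u)
    (hpos : ∀ u x, G.Adj u x → 0 < w u x)
    (s t : V) (hreach : G.Reachable s t)
    (lam OPT : ℝ)
    (hlam : IsLeast {l : ℝ | 0 ≤ l ∧ ActivatedPath G w (fun _ => l) s t} lam)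
    (hOPT : IsLeast {c : ℝ | ∃ p : V → ℝ, (∀ x, 0 ≤ p x) ∧ ActivatedPath G w p s t ∧
      c = ∑ x, p x} OPT) :
    lam ≤ OPT := by
  obtain ⟨p, hp, ⟨q, hq⟩, rfl⟩ := hOPT.1
  have hle : ∀ x, p x ≤ ∑ y, p y := fun x =>
    Finset.single_le_sum (fun y _ => hp y) (Finset.mem_univ x)
  exact hlam.2 ⟨Finset.sum_nonneg fun y _ => hp y, q, fun d hd =>
    (hq d hd).trans (add_le_add (hle _) (hle _))⟩
end
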